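/- (Associativity of the pathwise Itô integral, one-dimensional case) Let X be continuous with continuous quadratic variation [X] along grids (T_N). Let ξ be an admissible integrand for X and set Y_t := ∫_0^t ξ_s dX_s. Let η be an admissible integrand for Y (where Y has continuous quadratic variation [Y]_t = ∫_0^t ξ_s² d[X]_s). Then the product η ξ is an admissible integrand for X, and ∫_0^t η_s dY_s = ∫_0^t η_s ξ_s dX_s for all t ≥ 0. -/

import Mathlib

open Filter Topology Set MeasureTheory

/-- A refining sequence of time grids: each grid is a strictly increasing
sequence starting at 0 and tending to infinity; grids are nested and the
mesh tends to zero. -/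
structure GridSeq where
  T : ℕ → ℕ → ℝ
  zero : ∀ N, T N 0 = 0
  mono : ∀ N, StrictMono (T N)
  unbounded : ∀ N, Filter.Tendsto (T N) Filter.atTop Filter.atTop
  nested : ∀ N, Set.range (T N) ⊆ Set.range (T (N + 1))
  mesh : ∀ ε > 0, ∃ N₀, ∀ N ≥ N₀, ∀ i, T N (i + 1) - T N i ≤ ε

/-- The grid sum `∑_{t_i, t_{i+1} ∈ τ, t_{i+1} ≤ t} f(t_i, t_{i+1})`. -/
noncomputable def gridSum (τ : ℕ → ℝ) (f : ℝ → ℝ → ℝ) (t : ℝ) : ℝ :=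
  ∑' i : ℕ, if τ (i + 1) ≤ t then f (τ i) (τ (i + 1)) else 0

/-- The grid sums of `f` along the grid sequence `G` converge to `L` at time `t`. -/
def ConvTo (G : GridSeq) (f : ℝ → ℝ → ℝ) (t L : ℝ) : Prop :=
  Filter.Tendsto (fun N => gridSum (G.T N) f t) Filter.atTop (nhds L)

/-- `X` has continuous quadratic variation `Q` along the grid sequence `G`. -/
def HasQV (G : GridSeq) (X Q : ℝ → ℝ) : Prop :=
  ContinuousOn Q (Set.Ici 0) ∧ Q 0 = 0 ∧
    ∀ t, ConvTo G (fun u v => (X v - X u) ^ 2) t (Q t)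

/-- `A` is locally of finite variation on `[0,∞)`. -/
def LocBV (A : ℝ → ℝ) : Prop := ∀ T > 0, BoundedVariationOn A (Set.Icc 0 T)

/-- `ξ` is an admissible integrand for `X`: locally `ξ_t = g(A_t, X_t)` with
`g ∈ C¹` and `A` continuous of finite variation. -/
def Admissible (X ξ : ℝ → ℝ) : Prop :=
  ∀ T > 0, ∃ (n : ℕ) (g : (Fin n → ℝ) → ℝ → ℝ) (A : ℝ → Fin n → ℝ),
    ContDiff ℝ 1 (Function.uncurry g) ∧
    (∀ k, ContinuousOn (fun t => A t k) (Set.Icc 0 T) ∧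
      BoundedVariationOn (fun t => A t k) (Set.Icc 0 T)) ∧
    ∀ t ∈ Set.Icc (0 : ℝ) T, ξ t = g (A t) (X t)

section GridSums

/-- The number of intervals of the grid `τ` that are completed by time `t`. -/
noncomputable def lastIdx (τ : ℕ → ℝ) (t : ℝ) : ℕ := sInf {k | t < τ (k + 1)}

theorem GridSeq.lt_lastIdx_iff (G : GridSeq) (N : ℕ) (t : ℝ) (i : ℕ) :
    i < lastIdx (G.T N) t ↔ G.T N (i + 1) ≤ t := by
  have hne : {k | t < G.T N (k + 1)}.Nonempty :=
    (((tendsto_add_atTop_iff_nat 1).2 (G.unbounded N)).eventually_gt_atTop t).exists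
  constructor
  · intro h
    simpa using Nat.notMem_of_lt_sInf h
  · intro h
    by_contra! hle
    have h1 : t < G.T N (lastIdx (G.T N) t + 1) := Nat.sInf_mem hne
    have h2 := (G.mono N).monotone (Nat.add_le_add_right hle 1)
    linarith

theorem GridSeq.gridSum_eq_sum (G : GridSeq) (N : ℕ) (f : ℝ → ℝ → ℝ) (t : ℝ) :
    gridSum (G.T N) f t =
      ∑ i ∈ Finset.range (lastIdx (G.T N) t), f (G.T N i) (G.T N (i + 1)) := by
  rw [gridSum, tsum_eq_sum (s := Finset.range (lastIdx (G.T N) t))]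
  · refine Finset.sum_congr rfl fun i hi => ?_
    rw [if_pos ((G.lt_lastIdx_iff N t i).1 (Finset.mem_range.1 hi))]
  · intro i hi
    rw [if_neg fun h => hi (Finset.mem_range.2 ((G.lt_lastIdx_iff N t i).2 h))]

theorem GridSeq.nonneg (G : GridSeq) (N i : ℕ) : 0 ≤ G.T N i :=
  (G.zero N).symm.le.trans ((G.mono N).monotone (Nat.zero_le i))

theorem GridSeq.lastIdx_le (G : GridSeq) (N : ℕ) {t : ℝ} (ht : 0 ≤ t) :
    G.T N (lastIdx (G.T N) t) ≤ t := by
  rcases h : lastIdx (G.T N) t with _ | k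
  · rwa [G.zero]
  · exact (G.lt_lastIdx_iff N t k).1 (h ▸ Nat.lt_succ_self k)

theorem GridSeq.lt_lastIdx_succ (G : GridSeq) (N : ℕ) (t : ℝ) :
    t < G.T N (lastIdx (G.T N) t + 1) := by
  by_contra! h
  exact lt_irrefl _ ((G.lt_lastIdx_iff N t _).2 h)

theorem GridSeq.lastIdx_mono (G : GridSeq) (N : ℕ) {s t : ℝ} (hst : s ≤ t) :
    lastIdx (G.T N) s ≤ lastIdx (G.T N) t := by
  refine le_of_forall_lt fun i hi => ?_
  rw [G.lt_lastIdx_iff] at hi ⊢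
  exact hi.trans hst

theorem GridSeq.range_mono (G : GridSeq) {M N : ℕ} (h : M ≤ N) :
    Set.range (G.T M) ⊆ Set.range (G.T N) :=
  monotone_nat_of_le_succ (f := fun N => Set.range (G.T N)) G.nested h

theorem GridSeq.gridSum_le_gridSum (G : GridSeq) (N : ℕ) {f g : ℝ → ℝ → ℝ} {t : ℝ}
    (h : ∀ i, G.T N (i + 1) ≤ t → f (G.T N i) (G.T N (i + 1)) ≤ g (G.T N i) (G.T N (i + 1))) :
    gridSum (G.T N) f t ≤ gridSum (G.T N) g t := by
  rw [G.gridSum_eq_sum, G.gridSum_eq_sum]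
  exact Finset.sum_le_sum fun i hi =>
    h i ((G.lt_lastIdx_iff N t i).1 (Finset.mem_range.1 hi))

theorem GridSeq.gridSum_congr (G : GridSeq) (N : ℕ) {f g : ℝ → ℝ → ℝ} {t : ℝ}
    (h : ∀ i, G.T N (i + 1) ≤ t → f (G.T N i) (G.T N (i + 1)) = g (G.T N i) (G.T N (i + 1))) :
    gridSum (G.T N) f t = gridSum (G.T N) g t :=
  le_antisymm (G.gridSum_le_gridSum N fun i hi => (h i hi).le)
    (G.gridSum_le_gridSum N fun i hi => (h i hi).ge)

theorem GridSeq.gridSum_add (G : GridSeq) (N : ℕ) (f g : ℝ → ℝ → ℝ) (t : ℝ) :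
    gridSum (G.T N) (fun u v => f u v + g u v) t =
      gridSum (G.T N) f t + gridSum (G.T N) g t := by
  simp only [G.gridSum_eq_sum, Finset.sum_add_distrib]

theorem GridSeq.gridSum_sub (G : GridSeq) (N : ℕ) (f g : ℝ → ℝ → ℝ) (t : ℝ) :
    gridSum (G.T N) (fun u v => f u v - g u v) t =
      gridSum (G.T N) f t - gridSum (G.T N) g t := by
  simp only [G.gridSum_eq_sum, Finset.sum_sub_distrib]

theorem GridSeq.gridSum_const_mul (G : GridSeq) (N : ℕ) (c : ℝ) (f : ℝ → ℝ → ℝ) (t : ℝ) :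
    gridSum (G.T N) (fun u v => c * f u v) t = c * gridSum (G.T N) f t := by
  simp only [G.gridSum_eq_sum, Finset.mul_sum]

theorem GridSeq.gridSum_finsetSum (G : GridSeq) (N : ℕ) {ι : Type*} (s : Finset ι)
    (f : ι → ℝ → ℝ → ℝ) (t : ℝ) :
    gridSum (G.T N) (fun u v => ∑ k ∈ s, f k u v) t = ∑ k ∈ s, gridSum (G.T N) (f k) t := by
  simp only [G.gridSum_eq_sum]
  exact Finset.sum_comm

theorem GridSeq.abs_gridSum_le (G : GridSeq) (N : ℕ) (f : ℝ → ℝ → ℝ) (t : ℝ) :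
    |gridSum (G.T N) f t| ≤ gridSum (G.T N) (fun u v => |f u v|) t := by
  rw [G.gridSum_eq_sum, G.gridSum_eq_sum]
  exact Finset.abs_sum_le_sum_abs _ _

theorem GridSeq.gridSum_sub_gridSum (G : GridSeq) (N : ℕ) (f : ℝ → ℝ → ℝ) {s t : ℝ}
    (hst : s ≤ t) :
    gridSum (G.T N) f t - gridSum (G.T N) f s =
      ∑ i ∈ Finset.Ico (lastIdx (G.T N) s) (lastIdx (G.T N) t),
        f (G.T N i) (G.T N (i + 1)) := by
  rw [G.gridSum_eq_sum, G.gridSum_eq_sum, Finset.sum_Ico_eq_sub _ (G.lastIdx_mono N hst)]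

theorem GridSeq.gridSum_mono (G : GridSeq) (N : ℕ) {f : ℝ → ℝ → ℝ} (hf : ∀ u v, 0 ≤ f u v)
    {s t : ℝ} (hst : s ≤ t) : gridSum (G.T N) f s ≤ gridSum (G.T N) f t := by
  rw [← sub_nonneg, G.gridSum_sub_gridSum N f hst]
  exact Finset.sum_nonneg fun _ _ => hf _ _

theorem GridSeq.abs_gridSum_sub_gridSum_le (G : GridSeq) (N : ℕ) {f g : ℝ → ℝ → ℝ} {s t : ℝ}
    (hst : s ≤ t)
    (h : ∀ i, G.T N (i + 1) ≤ t → |f (G.T N i) (G.T N (i + 1))| ≤ g (G.T N i) (G.T N (i + 1))) :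
    |gridSum (G.T N) f t - gridSum (G.T N) f s| ≤ gridSum (G.T N) g t - gridSum (G.T N) g s := by
  rw [G.gridSum_sub_gridSum N f hst, G.gridSum_sub_gridSum N g hst]
  refine (Finset.abs_sum_le_sum_abs _ _).trans (Finset.sum_le_sum fun i hi => ?_)
  exact h i ((G.lt_lastIdx_iff N t i).1 (Finset.mem_Ico.1 hi).2)

theorem GridSeq.gridSum_increments (G : GridSeq) (N : ℕ) (h : ℝ → ℝ) (t : ℝ) :
    gridSum (G.T N) (fun u v => h v - h u) t = h (G.T N (lastIdx (G.T N) t)) - h 0 := by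
  rw [G.gridSum_eq_sum, Finset.sum_range_sub (fun i => h (G.T N i)), G.zero]

theorem GridSeq.dist_lastIdx_le (G : GridSeq) {ε : ℝ} (hε : 0 < ε) :
    ∀ᶠ N in atTop, ∀ t, 0 ≤ t → t - G.T N (lastIdx (G.T N) t) ≤ ε := by
  obtain ⟨N₀, hN₀⟩ := G.mesh ε hε
  filter_upwards [eventually_ge_atTop N₀] with N hN t _
  linarith [hN₀ N hN (lastIdx (G.T N) t), G.lt_lastIdx_succ N t]

theorem GridSeq.tendsto_lastIdx (G : GridSeq) {t : ℝ} (ht : 0 ≤ t) :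
    Tendsto (fun N => G.T N (lastIdx (G.T N) t)) atTop (𝓝[Icc 0 t] t) := by
  refine tendsto_nhdsWithin_iff.2 ⟨?_, Eventually.of_forall fun N =>
    ⟨G.nonneg N _, G.lastIdx_le N ht⟩⟩
  refine Metric.tendsto_nhds.2 fun ε hε => ?_
  filter_upwards [G.dist_lastIdx_le (half_pos hε)] with N hN
  rw [dist_comm, Real.dist_eq, abs_of_nonneg (sub_nonneg.2 (G.lastIdx_le N ht))]
  linarith [hN t ht]

/-- Grid sums of increments of a continuous function telescope in the limit. -/
theorem GridSeq.convTo_increments (G : GridSeq) {h : ℝ → ℝ} {T t : ℝ}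
    (hh : ContinuousOn h (Icc 0 T)) (ht : t ∈ Icc 0 T) :
    ConvTo G (fun u v => h v - h u) t (h t - h 0) := by
  simp only [ConvTo, G.gridSum_increments]
  have h1 := (hh t ht).mono (Icc_subset_Icc_right ht.2)
  exact (h1.tendsto.comp (G.tendsto_lastIdx ht.1)).sub_const _

end GridSums

section WeightedSums

/-- A real sequence that is approximated arbitrarily well by convergent sequences converges. -/
theorem exists_tendsto_of_approx {x : ℕ → ℝ} {P : Prop}
    (h : ∀ ε > 0, ∃ (y : ℕ → ℝ) (L : ℝ), Tendsto y atTop (𝓝 L) ∧ (P → L = 0) ∧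
      ∀ᶠ N in atTop, |x N - y N| ≤ ε) :
    ∃ L, Tendsto x atTop (𝓝 L) ∧ (P → L = 0) := by
  have hc : CauchySeq x := by
    refine Metric.cauchySeq_iff'.2 fun ε hε => ?_
    obtain ⟨y, L, hy, -, hxy⟩ := h (ε / 6) (by positivity)
    obtain ⟨N, hN⟩ :=
      (hxy.and (Metric.tendsto_nhds.1 hy (ε / 6) (by positivity))).exists_forall_of_atTop
    refine ⟨N, fun n hn => ?_⟩
    have h1 := abs_le.1 (hN n hn).1
    have h2 := abs_le.1 (hN N le_rfl).1
    have h3 := abs_lt.1 (hN n hn).2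
    have h4 := abs_lt.1 (hN N le_rfl).2
    rw [Real.dist_eq, abs_lt]
    constructor <;> linarith
  obtain ⟨L, hL⟩ := cauchySeq_tendsto_of_complete hc
  refine ⟨L, hL, fun hP => ?_⟩
  refine abs_nonpos_iff.1 (le_of_forall_pos_le_add fun ε hε => ?_)
  obtain ⟨y, L', hy, hL', hxy⟩ := h ε hε
  have h1 := le_of_tendsto (hL.sub hy).abs hxy
  rwa [hL' hP, sub_zero, ← zero_add ε] at h1

theorem GridSeq.gridSum_indicator (G : GridSeq) {M N : ℕ} (hMN : M ≤ N) (j : ℕ)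
    (F : ℝ → ℝ → ℝ) (t : ℝ) :
    gridSum (G.T N) (fun u v => if G.T M j ≤ u then F u v else 0) t =
      gridSum (G.T N) F t - gridSum (G.T N) F (min (G.T M j) t) := by
  obtain ⟨l, hl⟩ := G.range_mono hMN ⟨j, rfl⟩
  have h1 : gridSum (G.T N) F (min (G.T M j) t) =
      gridSum (G.T N) (fun u v => F u v - if G.T M j ≤ u then F u v else 0) t := by
    refine tsum_congr fun i => ?_
    have h2 : G.T M j ≤ G.T N i ↔ ¬ G.T N (i + 1) ≤ G.T M j := by
      rw [← hl, (G.mono N).le_iff_le, (G.mono N).le_iff_le]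
      omega
    simp only [le_min_iff, h2]
    by_cases ha : G.T N (i + 1) ≤ G.T M j <;> by_cases hb : G.T N (i + 1) ≤ t <;> simp [ha, hb]
  rw [h1, G.gridSum_sub]
  ring

/-- If the grid sums of `F` converge on `[0, T]` with bounded total mass, then so do the grid sums
of `F` weighted by a continuous function. -/
theorem GridSeq.exists_convTo_mul (G : GridSeq) {F : ℝ → ℝ → ℝ} {B w : ℝ → ℝ} {T C : ℝ}
    (hF : ∀ t ∈ Icc 0 T, ConvTo G F t (B t))
    (hC : ∀ᶠ N in atTop, gridSum (G.T N) (fun u v => |F u v|) T ≤ C)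
    (hw : ContinuousOn w (Icc 0 T)) {t : ℝ} (ht : t ∈ Icc 0 T) :
    ∃ L, ConvTo G (fun u v => w u * F u v) t L ∧ ((∀ s ∈ Icc 0 T, B s = 0) → L = 0) := by
  have hC0 : 0 ≤ |C| := abs_nonneg C
  refine exists_tendsto_of_approx fun ε hε => ?_
  have hunif := isCompact_Icc.uniformContinuousOn_of_continuous hw
  obtain ⟨δ, hδ, hwδ⟩ := Metric.uniformContinuousOn_iff_le.1 hunif (ε / (|C| + 1)) (by positivity)
  obtain ⟨M, hM⟩ := (G.dist_lastIdx_le hδ).exists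
  set J := lastIdx (G.T M) T with hJ
  let step : ℝ → ℝ := fun u => w 0 + gridSum (G.T M) (fun a b => w b - w a) u
  have hstep : ∀ u ∈ Icc 0 T, |w u - step u| ≤ ε / (|C| + 1) := by
    intro u hu
    simp only [step, G.gridSum_increments, add_sub_cancel]
    have hmem : G.T M (lastIdx (G.T M) u) ∈ Icc 0 T :=
      ⟨G.nonneg M _, (G.lastIdx_le M hu.1).trans hu.2⟩
    refine hwδ u hu _ hmem ?_
    rw [Real.dist_eq, abs_of_nonneg (sub_nonneg.2 (G.lastIdx_le M hu.1))]
    exact hM u hu.1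
  have hstep_eq : ∀ u ≤ T, step u = w 0 + ∑ j ∈ Finset.range J,
      if G.T M (j + 1) ≤ u then w (G.T M (j + 1)) - w (G.T M j) else 0 := by
    intro u hu
    simp only [step, G.gridSum_eq_sum]
    rw [← Finset.sum_filter]
    congr 2
    ext j
    simp only [Finset.mem_filter, Finset.mem_range, ← G.lt_lastIdx_iff]
    exact ⟨fun h => ⟨h.trans_le (G.lastIdx_mono M hu), h⟩, fun h => h.2⟩
  refine ⟨fun N => gridSum (G.T N) (fun u v => step u * F u v) t,
    w 0 * B t + ∑ j ∈ Finset.range J, (w (G.T M (j + 1)) - w (G.T M j)) *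
      (B t - B (min (G.T M (j + 1)) t)), ?_, ?_, ?_⟩
  · have hlim : Tendsto (fun N => w 0 * gridSum (G.T N) F t + ∑ j ∈ Finset.range J,
        (w (G.T M (j + 1)) - w (G.T M j)) *
          (gridSum (G.T N) F t - gridSum (G.T N) F (min (G.T M (j + 1)) t))) atTop
        (𝓝 (w 0 * B t + ∑ j ∈ Finset.range J, (w (G.T M (j + 1)) - w (G.T M j)) *
          (B t - B (min (G.T M (j + 1)) t)))) := by
      refine ((hF t ht).const_mul _).add (tendsto_finsetSum _ fun j _ => ?_)
      exact ((hF t ht).sub (hF _ ⟨le_min (G.nonneg M _) ht.1,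
        (min_le_right _ _).trans ht.2⟩)).const_mul _
    refine hlim.congr' ?_
    filter_upwards [eventually_ge_atTop M] with N hN
    simp only [← G.gridSum_indicator hN, ← G.gridSum_const_mul, ← G.gridSum_finsetSum,
      ← G.gridSum_add]
    refine G.gridSum_congr N fun i hi => ?_
    rw [hstep_eq _ (((G.mono N).monotone i.le_succ).trans (hi.trans ht.2)), add_mul,
      Finset.sum_mul]
    simp [ite_mul]
  · intro hB
    rw [hB t ht]
    simp only [mul_zero, zero_add]
    refine Finset.sum_eq_zero fun j _ => ?_
    rw [hB _ ⟨le_min (G.nonneg M _) ht.1, (min_le_right _ _).trans ht.2⟩, sub_zero, mul_zero]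
  · filter_upwards [hC] with N hN
    rw [← G.gridSum_sub]
    have h1 : gridSum (G.T N) (fun u v => |w u * F u v - step u * F u v|) t ≤
        gridSum (G.T N) (fun u v => ε / (|C| + 1) * |F u v|) t := by
      refine G.gridSum_le_gridSum N fun i hi => ?_
      rw [← sub_mul, abs_mul]
      refine mul_le_mul_of_nonneg_right (hstep _ ⟨G.nonneg N _, ?_⟩) (abs_nonneg _)
      exact ((G.mono N).monotone i.le_succ).trans (hi.trans ht.2)
    refine (G.abs_gridSum_le N _ t).trans (h1.trans ?_)
    rw [G.gridSum_const_mul]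
    have h2 : gridSum (G.T N) (fun u v => |F u v|) t ≤ |C| :=
      (G.gridSum_mono N (fun _ _ => abs_nonneg _) ht.2).trans (hN.trans (le_abs_self C))
    calc ε / (|C| + 1) * gridSum (G.T N) (fun u v => |F u v|) t
        ≤ ε / (|C| + 1) * (|C| + 1) := by gcongr; linarith
      _ = ε := by field_simp

end WeightedSums

section Variation

/-- The variation function of a continuous function of bounded variation is continuous. -/
theorem continuousOn_variationOnFromTo {A : ℝ → ℝ} {s : Set ℝ} {a : ℝ} (ha : a ∈ s)
    (hc : ContinuousOn A s) (hA : BoundedVariationOn A s) :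
    ContinuousOn (variationOnFromTo A s a) s := by
  intro b hb
  have hl := variationOnFromTo.tendsto_left ha hb hA.locallyBoundedVariationOn
    ((hc b hb).mono inter_subset_left : ContinuousWithinAt A (s ∩ Iio b) b)
  have hr := variationOnFromTo.tendsto_right ha hb hA.locallyBoundedVariationOn
    ((hc b hb).mono inter_subset_left : ContinuousWithinAt A (s ∩ Ioi b) b)
  rw [dist_self, sub_zero] at hl
  rw [dist_self, add_zero] at hr
  have hs : s ⊆ (s ∩ Iio b) ∪ ({b} ∪ (s ∩ Ioi b)) := by
    intro x hx
    rcases lt_trichotomy x b with h | h | h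
    · exact Or.inl ⟨hx, h⟩
    · exact Or.inr (Or.inl h)
    · exact Or.inr (Or.inr ⟨hx, h⟩)
  exact (ContinuousWithinAt.union hl (continuousWithinAt_singleton.union hr)).mono hs

/-- A function whose increments are dominated by those of a function `m` on an interval has bounded
variation there. -/
theorem boundedVariationOn_of_abs_sub_le {B m : ℝ → ℝ} {T : ℝ} (hT : 0 ≤ T)
    (h : ∀ s ∈ Icc 0 T, ∀ t ∈ Icc 0 T, s ≤ t → |B t - B s| ≤ m t - m s) :
    BoundedVariationOn B (Icc 0 T) := by
  have hm : MonotoneOn m (Icc 0 T) := fun s hs t ht hst =>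
    sub_nonneg.1 ((abs_nonneg _).trans (h s hs t ht hst))
  have hmv := (hm.eVariationOn_eq (left_mem_Icc.2 hT) (right_mem_Icc.2 hT)).le
  rw [inter_self] at hmv
  refine ne_top_of_le_ne_top ENNReal.ofReal_ne_top (le_trans ?_ hmv)
  refine iSup_le fun p => ?_
  refine le_trans (Finset.sum_le_sum fun i _ => ?_) (eVariationOn.sum_le p.2.2.1 p.2.2.2)
  have h1 := h _ (p.2.2.2 i) _ (p.2.2.2 (i + 1)) (p.2.2.1 i.le_succ)
  rw [edist_dist, edist_dist, Real.dist_eq, Real.dist_eq]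
  exact ENNReal.ofReal_le_ofReal (h1.trans (le_abs_self _))

theorem continuousOn_of_abs_sub_le {B m : ℝ → ℝ} {T : ℝ} (hm : ContinuousOn m (Icc 0 T))
    (h : ∀ s ∈ Icc 0 T, ∀ t ∈ Icc 0 T, s ≤ t → |B t - B s| ≤ m t - m s) :
    ContinuousOn B (Icc 0 T) := by
  intro s hs
  refine tendsto_iff_dist_tendsto_zero.2 (squeeze_zero' (Eventually.of_forall fun _ => dist_nonneg)
    ?_ (tendsto_iff_dist_tendsto_zero.1 (hm s hs)))
  filter_upwards [self_mem_nhdsWithin] with t ht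
  rw [Real.dist_eq, Real.dist_eq]
  rcases le_total s t with hst | hst
  · exact (h s hs t ht hst).trans (le_abs_self _)
  · rw [abs_sub_comm, abs_sub_comm (m t)]
    exact (h t ht s hs hst).trans (le_abs_self _)

end Variation

section Calculus

/-- The integral over `[0, 1]` of a `C¹` function is `C¹` in the parameter. -/
theorem contDiff_one_intervalIntegral {E : Type*} [NormedAddCommGroup E] [NormedSpace ℝ E]
    [ProperSpace E] {F : E → ℝ → ℝ} (hF : ContDiff ℝ 1 (Function.uncurry F)) :
    ContDiff ℝ 1 fun p => ∫ s in (0 : ℝ)..1, F p s := by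
  let F' : E → ℝ → E →L[ℝ] ℝ := fun p s =>
    (fderiv ℝ (Function.uncurry F) (p, s)).comp (ContinuousLinearMap.inl ℝ E ℝ)
  have hF'c : Continuous (Function.uncurry F') :=
    (hF.continuous_fderiv one_ne_zero).clm_comp continuous_const
  refine contDiff_one_iff_hasFDerivAt.2 ⟨fun p => ∫ s in (0 : ℝ)..1, F' p s,
    intervalIntegral.continuous_parametric_intervalIntegral_of_continuous' hF'c 0 1, fun p => ?_⟩
  obtain ⟨C, hC⟩ := ((isCompact_closedBall p 1).prod (isCompact_Icc (a := (0 : ℝ)) (b := 1))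
    ).exists_bound_of_continuousOn hF'c.continuousOn
  refine intervalIntegral.hasFDerivAt_integral_of_dominated_of_fderiv_le (𝕜 := ℝ)
    (bound := fun _ => C)
    (Metric.closedBall_mem_nhds p one_pos) (Eventually.of_forall fun q => ?_) ?_ ?_ ?_ ?_ ?_
  · exact (hF.continuous.comp (Continuous.prodMk_right q)).aestronglyMeasurable
  · exact (hF.continuous.comp (Continuous.prodMk_right p)).intervalIntegrable _ _
  · exact (hF'c.comp (Continuous.prodMk_right p)).aestronglyMeasurable
  · refine Eventually.of_forall fun s hs q hq => hC (q, s) ⟨hq, ?_⟩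
    rw [uIoc_of_le zero_le_one] at hs
    exact Ioc_subset_Icc_self hs
  · exact intervalIntegrable_const
  · refine Eventually.of_forall fun s _ q _ => ?_
    exact ((hF.differentiable one_ne_zero) (q, s)).hasFDerivAt.comp (f := fun r => (r, s)) q
      (hasFDerivAt_prodMk_left q s)

/-- A `C¹` function has a primitive in its last variable that is jointly `C¹`. -/
theorem exists_contDiff_primitive {E : Type*} [NormedAddCommGroup E] [NormedSpace ℝ E]
    [ProperSpace E] {g : E → ℝ → ℝ} (hg : ContDiff ℝ 1 (Function.uncurry g)) :
    ∃ f : E → ℝ → ℝ, ContDiff ℝ 1 (Function.uncurry f) ∧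
      ∀ a x, HasDerivAt (f a) (g a x) x := by
  refine ⟨fun a x => ∫ y in (0 : ℝ)..x, g a y, ?_, fun a x => ?_⟩
  · have hcomp : ContDiff ℝ 1 (Function.uncurry fun (p : E × ℝ) (s : ℝ) => g p.1 (s * p.2)) :=
      hg.comp (contDiff_fst.fst.prodMk (contDiff_snd.mul contDiff_fst.snd))
    have heq : (Function.uncurry fun a x => ∫ y in (0 : ℝ)..x, g a y) =
        fun p : E × ℝ => p.2 * ∫ s in (0 : ℝ)..1, g p.1 (s * p.2) := by
      ext p
      simp [Function.uncurry, intervalIntegral.mul_integral_comp_mul_right]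
    rw [heq]
    exact contDiff_snd.mul (contDiff_one_intervalIntegral hcomp)
  · have hc : Continuous (g a) := hg.continuous.comp (Continuous.prodMk_right a)
    exact intervalIntegral.integral_hasDerivAt_right (hc.intervalIntegrable _ _)
      (hc.stronglyMeasurableAtFilter _ _) hc.continuousAt

/-- Taylor estimate on a convex set where `Df` and `Dg` oscillate by at most `ε`, with `g = ∂ₓf`:
the expansion is of first order in `a` and of second order in `x`. -/
theorem taylor_remainder_le {n : ℕ} {f g : (Fin n → ℝ) → ℝ → ℝ}
    (hf : Differentiable ℝ (Function.uncurry f)) (hg : Differentiable ℝ (Function.uncurry g))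
    (hfg : ∀ a x, HasDerivAt (f a) (g a x) x) {S : Set ((Fin n → ℝ) × ℝ)} (hS : Convex ℝ S)
    {a a' : Fin n → ℝ} {x x' ε : ℝ} (h00 : (a, x) ∈ S) (h01 : (a, x') ∈ S) (h11 : (a', x') ∈ S)
    (hDf : ∀ q ∈ S, ‖fderiv ℝ (Function.uncurry f) q - fderiv ℝ (Function.uncurry f) (a, x)‖ ≤ ε)
    (hDg : ∀ q ∈ S, ‖fderiv ℝ (Function.uncurry g) q - fderiv ℝ (Function.uncurry g) (a, x)‖ ≤ ε) :
    |f a' x' - f a x - g a x * (x' - x) -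
      (∑ k, fderiv ℝ (Function.uncurry f) (a, x) (Pi.single k 1, 0) * (a' k - a k) +
        1 / 2 * fderiv ℝ (Function.uncurry g) (a, x) (0, 1) * (x' - x) ^ 2)| ≤
      ε * (∑ k, |a' k - a k| + (x' - x) ^ 2) := by
  have hε : 0 ≤ ε := (norm_nonneg _).trans (hDf _ h00)
  set φ := fderiv ℝ (Function.uncurry f) (a, x)
  set ψ := fderiv ℝ (Function.uncurry g) (a, x)
  have hψ : ∀ r : ℝ, ψ (0, r) = r * ψ (0, 1) := fun r => by
    rw [← smul_eq_mul, ← map_smul]; simp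
  have hφ : φ (a' - a, 0) = ∑ k, φ (Pi.single k 1, 0) * (a' k - a k) := by
    have h1 : (a' - a, (0 : ℝ)) =
        ∑ k, (a' k - a k) • ((Pi.single k 1 : Fin n → ℝ), (0 : ℝ)) := by
      ext k
      · simp [Prod.fst_sum, Finset.sum_apply, Pi.single_apply]
      · simp [Prod.snd_sum]
    rw [h1, map_sum]
    exact Finset.sum_congr rfl fun k _ => by rw [map_smul, smul_eq_mul, mul_comm]
  have hfirst : |f a' x' - f a x' - φ (a' - a, 0)| ≤ ε * ∑ k, |a' k - a k| := by
    have h1 := hS.norm_image_sub_le_of_norm_fderiv_le' (𝕜 := ℝ) (fun q _ => hf q) hDf h01 h11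
    have h2 : ‖(a', x') - (a, x')‖ ≤ ∑ k, |a' k - a k| := by
      rw [Prod.mk_sub_mk, sub_self, Prod.norm_mk, norm_zero, max_eq_left (norm_nonneg _)]
      exact (pi_norm_le_iff_of_nonneg (Finset.sum_nonneg fun _ _ => abs_nonneg _)).2 fun k =>
        Finset.single_le_sum (f := fun k => |a' k - a k|) (fun _ _ => abs_nonneg _)
          (Finset.mem_univ k)
    rw [Prod.mk_sub_mk, sub_self, Real.norm_eq_abs] at h1
    rw [Prod.mk_sub_mk, sub_self] at h2
    exact h1.trans (mul_le_mul_of_nonneg_left h2 hε)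
  have hsecond : |f a x' - f a x - g a x * (x' - x) - 1 / 2 * ψ (0, 1) * (x' - x) ^ 2| ≤
      ε * (x' - x) ^ 2 := by
    let r : ℝ → ℝ := fun y => f a y - g a x * (y - x) - 1 / 2 * ψ (0, 1) * (y - x) ^ 2
    have hr : ∀ y, HasDerivAt r (g a y - g a x - (y - x) * ψ (0, 1)) y := fun y => by
      have hid := (hasDerivAt_id y).sub_const x
      refine (((hfg a y).sub (hid.const_mul (g a x))).sub
        ((hid.pow 2).const_mul (1 / 2 * ψ (0, 1)))).congr_deriv ?_
      simp
      ring
    have hbound : ∀ y ∈ uIcc x x', ‖g a y - g a x - (y - x) * ψ (0, 1)‖ ≤ ε * |x' - x| := by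
      intro y hy
      have hyS : (a, y) ∈ S := by
        refine hS.segment_subset h00 h01 ?_
        rw [← Prod.image_mk_segment_right, segment_eq_uIcc]
        exact mem_image_of_mem _ hy
      have h1 := hS.norm_image_sub_le_of_norm_fderiv_le' (𝕜 := ℝ) (fun q _ => hg q) hDg h00 hyS
      rw [Prod.mk_sub_mk, sub_self, Prod.norm_mk, norm_zero, max_eq_right (norm_nonneg _),
        hψ] at h1
      exact h1.trans (mul_le_mul_of_nonneg_left (abs_sub_left_of_mem_uIcc hy) hε)
    have h2 := (convex_uIcc x x').norm_image_sub_le_of_norm_hasDerivWithin_le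
      (fun y _ => (hr y).hasDerivWithinAt) hbound left_mem_uIcc right_mem_uIcc
    simp only [r, Real.norm_eq_abs, mul_assoc, abs_mul_abs_self] at h2
    convert h2 using 2 <;> ring
  rw [← hφ]
  calc _ = |(f a' x' - f a x' - φ (a' - a, 0)) +
        (f a x' - f a x - g a x * (x' - x) - 1 / 2 * ψ (0, 1) * (x' - x) ^ 2)| := by
        congr 1; ring
    _ ≤ _ := (abs_add_le _ _).trans (by rw [mul_add]; exact add_le_add hfirst hsecond)

/-- Second-order Taylor expansion of `f (A t) (X t)` along continuous paths, of first order in `A`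
and of second order in `X`, with a uniform remainder. -/
theorem exists_taylor_coefficients {n : ℕ} {f g : (Fin n → ℝ) → ℝ → ℝ}
    (hf : ContDiff ℝ 1 (Function.uncurry f)) (hg : ContDiff ℝ 1 (Function.uncurry g))
    (hfg : ∀ a x, HasDerivAt (f a) (g a x) x) {A : ℝ → Fin n → ℝ} {X : ℝ → ℝ} {T : ℝ}
    (hA : ∀ k, ContinuousOn (fun t => A t k) (Icc 0 T)) (hX : ContinuousOn X (Icc 0 T)) :
    ∃ (α : Fin n → ℝ → ℝ) (β : ℝ → ℝ), (∀ k, ContinuousOn (α k) (Icc 0 T)) ∧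
      ContinuousOn β (Icc 0 T) ∧ ∀ ε > 0, ∃ δ > 0, ∀ u ∈ Icc 0 T, ∀ v ∈ Icc 0 T, |v - u| ≤ δ →
        |f (A v) (X v) - f (A u) (X u) - g (A u) (X u) * (X v - X u) -
          (∑ k, α k u * (A v k - A u k) + β u * (X v - X u) ^ 2)| ≤
        ε * (∑ k, |A v k - A u k| + (X v - X u) ^ 2) := by
  set Df := fderiv ℝ (Function.uncurry f)
  set Dg := fderiv ℝ (Function.uncurry g)
  have hDf : Continuous Df := hf.continuous_fderiv one_ne_zero
  have hDg : Continuous Dg := hg.continuous_fderiv one_ne_zero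
  have hAX : ContinuousOn (fun t => (A t, X t)) (Icc 0 T) := (continuousOn_pi.2 hA).prodMk hX
  refine ⟨fun k t => Df (A t, X t) (Pi.single k 1, 0), fun t => 1 / 2 * Dg (A t, X t) (0, 1),
    fun k => (hDf.comp_continuousOn hAX).clm_apply continuousOn_const,
    continuousOn_const.mul ((hDg.comp_continuousOn hAX).clm_apply continuousOn_const), ?_⟩
  intro ε hε
  obtain ⟨R, hR⟩ := (isCompact_Icc.image_of_continuousOn hAX).isBounded.subset_closedBall 0
  have hmem : ∀ t ∈ Icc 0 T, (A t, X t) ∈ Metric.closedBall (0 : (Fin n → ℝ) × ℝ) R :=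
    fun t ht => hR (mem_image_of_mem _ ht)
  have hK := isCompact_closedBall (0 : (Fin n → ℝ) × ℝ) R
  obtain ⟨δ₁, hδ₁, h₁⟩ := Metric.uniformContinuousOn_iff.1
    (hK.uniformContinuousOn_of_continuous hDf.continuousOn) ε hε
  obtain ⟨δ₂, hδ₂, h₂⟩ := Metric.uniformContinuousOn_iff.1
    (hK.uniformContinuousOn_of_continuous hDg.continuousOn) ε hε
  obtain ⟨δ, hδ, h₃⟩ := Metric.uniformContinuousOn_iff_le.1
    (isCompact_Icc.uniformContinuousOn_of_continuous hAX) (min δ₁ δ₂ / 2) (by positivity)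
  refine ⟨δ, hδ, fun u hu v hv huv => ?_⟩
  have hdist : dist (A v, X v) (A u, X u) < min δ₁ δ₂ :=
    (h₃ v hv u hu huv).trans_lt (half_lt_self (lt_min hδ₁ hδ₂))
  have hS := (convex_closedBall (0 : (Fin n → ℝ) × ℝ) R).inter (convex_ball (A u, X u) (min δ₁ δ₂))
  refine taylor_remainder_le (hf.differentiable one_ne_zero) (hg.differentiable one_ne_zero) hfg hS
    ⟨hmem u hu, Metric.mem_ball_self (lt_min hδ₁ hδ₂)⟩ ⟨?_, ?_⟩ ⟨hmem v hv, hdist⟩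
    (fun q hq => ?_) (fun q hq => ?_)
  · have hu' := mem_closedBall_zero_iff.1 (hmem u hu)
    have hv' := mem_closedBall_zero_iff.1 (hmem v hv)
    rw [mem_closedBall_zero_iff, Prod.norm_mk]
    exact max_le ((norm_fst_le _).trans hu') ((norm_snd_le _).trans hv')
  · rw [Metric.mem_ball, dist_prod_same_left]
    exact (le_max_right _ _).trans_lt hdist
  · rw [← dist_eq_norm]
    exact (h₁ q hq.1 _ (hmem u hu) (hq.2.trans_le (min_le_left _ _))).le
  · rw [← dist_eq_norm]
    exact (h₂ q hq.1 _ (hmem u hu) (hq.2.trans_le (min_le_right _ _))).le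

end Calculus

section ItoFormula

/-- `F` is dominated on `[0, T]`, eventually along the grids, by some `P` whose grid sums
converge to a function `m` that is continuous on `[0, T]`. -/
def DominatedBy (G : GridSeq) (F P : ℝ → ℝ → ℝ) (m : ℝ → ℝ) (T : ℝ) : Prop :=
  ContinuousOn m (Icc 0 T) ∧ (∀ t ∈ Icc 0 T, ConvTo G P t (m t)) ∧
    ∀ᶠ N in atTop, ∀ i, G.T N (i + 1) ≤ T →
      |F (G.T N i) (G.T N (i + 1))| ≤ P (G.T N i) (G.T N (i + 1))

theorem DominatedBy.abs_sub_le {G : GridSeq} {F P : ℝ → ℝ → ℝ} {m L : ℝ → ℝ} {T : ℝ}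
    (h : DominatedBy G F P m T) (hL : ∀ t ∈ Icc 0 T, ConvTo G F t (L t)) :
    ∀ s ∈ Icc 0 T, ∀ t ∈ Icc 0 T, s ≤ t → |L t - L s| ≤ m t - m s := by
  intro s hs t ht hst
  refine le_of_tendsto_of_tendsto ((hL t ht).sub (hL s hs)).abs ((h.2.1 t ht).sub (h.2.1 s hs)) ?_
  filter_upwards [h.2.2] with N hN
  exact G.abs_gridSum_sub_gridSum_le N hst fun i hi => hN i (hi.trans ht.2)

theorem ConvTo.eventually_le {G : GridSeq} {P : ℝ → ℝ → ℝ} {t L : ℝ} (h : ConvTo G P t L) :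
    ∀ᶠ N in atTop, gridSum (G.T N) P t ≤ L + 1 :=
  (Tendsto.eventually_lt_const (lt_add_one L) h).mono fun _ => le_of_lt

theorem GridSeq.left_mem_Icc (G : GridSeq) {N i : ℕ} {T : ℝ} (h : G.T N (i + 1) ≤ T) :
    G.T N i ∈ Icc 0 T :=
  ⟨G.nonneg N i, ((G.mono N).monotone i.le_succ).trans h⟩

theorem GridSeq.right_mem_Icc (G : GridSeq) {N i : ℕ} {T : ℝ} (h : G.T N (i + 1) ≤ T) :
    G.T N (i + 1) ∈ Icc 0 T :=
  ⟨G.nonneg N _, h⟩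

/-- Föllmer's pathwise Itô formula: the grid sums of the defect
`f(A_v, X_v) - f(A_u, X_u) - ∂ₓf(A_u, X_u) (X_v - X_u)` converge, and the defect is dominated. -/
theorem ito_defect (G : GridSeq) {X Q : ℝ → ℝ} {T : ℝ} (hT : 0 < T)
    (hX : ContinuousOn X (Icc 0 T)) (hQ : HasQV G X Q) {n : ℕ} {f g : (Fin n → ℝ) → ℝ → ℝ}
    (hf : ContDiff ℝ 1 (Function.uncurry f)) (hg : ContDiff ℝ 1 (Function.uncurry g))
    (hfg : ∀ a x, HasDerivAt (f a) (g a x) x) {A : ℝ → Fin n → ℝ}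
    (hA : ∀ k, ContinuousOn (fun t => A t k) (Icc 0 T) ∧
      BoundedVariationOn (fun t => A t k) (Icc 0 T)) :
    (∃ P m, DominatedBy G
      (fun u v => f (A v) (X v) - f (A u) (X u) - g (A u) (X u) * (X v - X u)) P m T) ∧
    ∀ t ∈ Icc 0 T, ∃ L, ConvTo G
      (fun u v => f (A v) (X v) - f (A u) (X u) - g (A u) (X u) * (X v - X u)) t L := by
  have h0 : (0 : ℝ) ∈ Icc 0 T := left_mem_Icc.2 hT.le
  have hTT : T ∈ Icc 0 T := right_mem_Icc.2 hT.le
  obtain ⟨α, β, hα, hβ, hTaylor⟩ := exists_taylor_coefficients hf hg hfg (fun k => (hA k).1) hX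
  set F : ℝ → ℝ → ℝ := fun u v =>
    f (A v) (X v) - f (A u) (X u) - g (A u) (X u) * (X v - X u) with hFdef
  let D : ℝ → ℝ → ℝ := fun u v => ∑ k, α k u * (A v k - A u k) + β u * (X v - X u) ^ 2
  let V : Fin n → ℝ → ℝ := fun k => variationOnFromTo (fun t => A t k) (Icc 0 T) 0
  let R : ℝ → ℝ → ℝ := fun u v => ∑ k, (V k v - V k u) + (X v - X u) ^ 2
  let m : ℝ → ℝ := fun t => ∑ k, (V k t - V k 0) + Q t
  have hVc : ∀ k, ContinuousOn (V k) (Icc 0 T) := fun k =>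
    continuousOn_variationOnFromTo h0 (hA k).1 (hA k).2
  have hQc : ContinuousOn Q (Icc 0 T) := hQ.1.mono Icc_subset_Ici_self
  have hm : ContinuousOn m (Icc 0 T) :=
    (continuousOn_finsetSum _ fun k _ => (hVc k).sub continuousOn_const).add hQc
  have hR : ∀ t ∈ Icc 0 T, ConvTo G R t (m t) := by
    intro t ht
    simp only [ConvTo, R, G.gridSum_add, G.gridSum_finsetSum]
    exact (tendsto_finsetSum _ fun k _ => G.convTo_increments (hVc k) ht).add (hQ.2.2 t)
  have hAV : ∀ k, ∀ u ∈ Icc 0 T, ∀ v ∈ Icc 0 T, u ≤ v → |A v k - A u k| ≤ V k v - V k u :=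
    fun k u hu v hv huv => variationOnFromTo.abs_sub_le_sub_of_le
      (hA k).2.locallyBoundedVariationOn h0 hu hv huv
  have hRle : ∀ u ∈ Icc 0 T, ∀ v ∈ Icc 0 T, u ≤ v →
      ∑ k, |A v k - A u k| + (X v - X u) ^ 2 ≤ R u v := fun u hu v hv huv =>
    add_le_add_left (Finset.sum_le_sum fun k _ => hAV k u hu v hv huv) _
  have hlocal : ∀ ε > 0, ∀ᶠ N in atTop, ∀ i, G.T N (i + 1) ≤ T →
      |F (G.T N i) (G.T N (i + 1)) - D (G.T N i) (G.T N (i + 1))| ≤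
        ε * R (G.T N i) (G.T N (i + 1)) := by
    intro ε hε
    obtain ⟨δ, hδ, h⟩ := hTaylor ε hε
    obtain ⟨N₀, hN₀⟩ := G.mesh δ hδ
    filter_upwards [eventually_ge_atTop N₀] with N hN i hi
    have hle : G.T N i ≤ G.T N (i + 1) := (G.mono N).monotone i.le_succ
    refine (h _ (G.left_mem_Icc hi) _ (G.right_mem_Icc hi) ?_).trans
      (mul_le_mul_of_nonneg_left (hRle _ (G.left_mem_Icc hi) _ (G.right_mem_Icc hi) hle) hε.le)
    rw [abs_of_nonneg (sub_nonneg.2 hle)]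
    exact hN₀ N hN i
  refine ⟨?_, fun t ht => ?_⟩
  · have hbdd : ∃ C, ∀ u ∈ Icc 0 T, (∀ k, |α k u| ≤ C) ∧ |β u| ≤ C := by
      obtain ⟨C, hC⟩ := isCompact_Icc.exists_bound_of_continuousOn
        ((continuousOn_pi.2 hα).prodMk hβ)
      refine ⟨C, fun u hu => ⟨fun k => ?_, ?_⟩⟩
      · exact (norm_le_pi_norm (fun k => α k u) k).trans ((norm_fst_le _).trans (hC u hu))
      · exact (norm_snd_le (fun k => α k u, β u)).trans (hC u hu)
    obtain ⟨C, hC⟩ := hbdd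
    have hC0 : 0 ≤ C := (abs_nonneg _).trans (hC 0 h0).2
    refine ⟨fun u v => (C + 1) * R u v, fun t => (C + 1) * m t, continuousOn_const.mul hm,
      fun t ht => ?_, ?_⟩
    · simp only [ConvTo, G.gridSum_const_mul]
      exact (hR t ht).const_mul _
    · filter_upwards [hlocal 1 one_pos] with N hN i hi
      set u := G.T N i
      set v := G.T N (i + 1)
      have hu : u ∈ Icc 0 T := G.left_mem_Icc hi
      have hv : v ∈ Icc 0 T := G.right_mem_Icc hi
      have hD : |D u v| ≤ C * R u v := by
        have h1 : |∑ k, α k u * (A v k - A u k)| ≤ ∑ k, C * |A v k - A u k| := by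
          refine (Finset.abs_sum_le_sum_abs _ _).trans (Finset.sum_le_sum fun k _ => ?_)
          rw [abs_mul]
          exact mul_le_mul_of_nonneg_right ((hC u hu).1 k) (abs_nonneg _)
        have h2 : |β u * (X v - X u) ^ 2| ≤ C * (X v - X u) ^ 2 := by
          rw [abs_mul, abs_of_nonneg (sq_nonneg (X v - X u))]
          exact mul_le_mul_of_nonneg_right (hC u hu).2 (sq_nonneg _)
        refine (abs_add_le _ _).trans ((add_le_add h1 h2).trans ?_)
        rw [← Finset.mul_sum, ← mul_add]
        exact mul_le_mul_of_nonneg_left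
          (hRle u hu v hv ((G.mono N).monotone i.le_succ)) hC0
      calc |F u v| = |(F u v - D u v) + D u v| := by rw [sub_add_cancel]
        _ ≤ 1 * R u v + C * R u v := (abs_add_le _ _).trans (add_le_add (hN i hi) hD)
        _ = (C + 1) * R u v := by ring
  · have hDconv : ∃ L, ConvTo G D t L := by
      have h1 : ∀ k, ∃ L, ConvTo G (fun u v => α k u * (A v k - A u k)) t L := by
        intro k
        have hbd : ∀ᶠ N in atTop, gridSum (G.T N) (fun u v => |A v k - A u k|) T ≤
            V k T - V k 0 + 1 := by
          filter_upwards [(G.convTo_increments (hVc k) hTT).eventually_le] with N hN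
          exact (G.gridSum_le_gridSum N fun i hi => hAV k _ (G.left_mem_Icc hi) _
            (G.right_mem_Icc hi) ((G.mono N).monotone i.le_succ)).trans hN
        obtain ⟨L, hL, -⟩ := G.exists_convTo_mul (fun s hs => G.convTo_increments (hA k).1 hs)
          hbd (hα k) ht
        exact ⟨L, hL⟩
      choose L hL using h1
      have hbd : ∀ᶠ N in atTop, gridSum (G.T N) (fun u v => |(X v - X u) ^ 2|) T ≤ Q T + 1 := by
        simp only [abs_sq]
        exact (hQ.2.2 T).eventually_le
      obtain ⟨L', hL', -⟩ := G.exists_convTo_mul (fun s _ => hQ.2.2 s) hbd hβ ht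
      refine ⟨∑ k, L k + L', ?_⟩
      simp only [ConvTo, D, G.gridSum_add, G.gridSum_finsetSum]
      exact (tendsto_finsetSum _ fun k _ => hL k).add hL'
    obtain ⟨L, hL⟩ := hDconv
    obtain ⟨L', hL', -⟩ := exists_tendsto_of_approx
      (x := fun N => gridSum (G.T N) F t) (P := False) fun ε hε => by
      refine ⟨fun N => gridSum (G.T N) D t, L, hL, False.elim, ?_⟩
      have hpos : 0 < |m t| + 1 := by positivity
      filter_upwards [hlocal (ε / (|m t| + 1)) (by positivity), (hR t ht).eventually_le]
        with N hN hRN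
      rw [← G.gridSum_sub]
      refine (G.abs_gridSum_le N _ t).trans ((G.gridSum_le_gridSum N
        (g := fun u v => ε / (|m t| + 1) * R u v) fun i hi => hN i (hi.trans ht.2)).trans ?_)
      rw [G.gridSum_const_mul, div_mul_eq_mul_div, div_le_iff₀ hpos]
      exact mul_le_mul_of_nonneg_left
        (hRN.trans (add_le_add_left (le_abs_self _) _)) hε.le
    exact ⟨L', hL'⟩

/-- On `[0, T]`, an admissible integrand `ξ = g(A, X)` has a pathwise Itô integral of the form
`Y = f(A, X) - B` with `B` continuous of finite variation, and the grid sums of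
`|Y_v - Y_u - ξ_u (X_v - X_u)|` are bounded. -/
theorem exists_integral_representation (G : GridSeq) {X Q ξ Y : ℝ → ℝ} {T : ℝ} (hT : 0 < T)
    (hX : ContinuousOn X (Icc 0 T)) (hQ : HasQV G X Q) (hξ : Admissible X ξ)
    (hY : ∀ t, ConvTo G (fun u v => ξ u * (X v - X u)) t (Y t)) :
    ∃ (n : ℕ) (f g : (Fin n → ℝ) → ℝ → ℝ) (A : ℝ → Fin n → ℝ) (B : ℝ → ℝ) (C : ℝ),
      ContDiff ℝ 1 (Function.uncurry f) ∧ ContDiff ℝ 1 (Function.uncurry g) ∧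
      (∀ k, ContinuousOn (fun t => A t k) (Icc 0 T) ∧
        BoundedVariationOn (fun t => A t k) (Icc 0 T)) ∧
      ContinuousOn B (Icc 0 T) ∧ BoundedVariationOn B (Icc 0 T) ∧
      (∀ t ∈ Icc 0 T, ξ t = g (A t) (X t)) ∧ (∀ t, Y t = f (A t) (X t) - B t) ∧
      ∀ᶠ N in atTop, gridSum (G.T N) (fun u v => |Y v - Y u - ξ u * (X v - X u)|) T ≤ C := by
  obtain ⟨n, g, A, hg, hA, hξg⟩ := hξ T hT
  obtain ⟨f, hf, hfg⟩ := exists_contDiff_primitive hg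
  obtain ⟨⟨P, m, hdom⟩, -⟩ := ito_defect G hT hX hQ hf hg hfg hA
  let Z : ℝ → ℝ := fun t => f (A t) (X t)
  have hZ : ContinuousOn Z (Icc 0 T) :=
    hf.continuous.comp_continuousOn ((continuousOn_pi.2 fun k => (hA k).1).prodMk hX)
  have hconv : ∀ t ∈ Icc 0 T, ConvTo G
      (fun u v => f (A v) (X v) - f (A u) (X u) - g (A u) (X u) * (X v - X u)) t
      (Z t - Z 0 - Y t) := by
    intro t ht
    refine ((G.convTo_increments hZ ht).sub (hY t)).congr fun N => ?_
    rw [← G.gridSum_sub]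
    exact G.gridSum_congr N fun i hi => by
      rw [hξg _ (G.left_mem_Icc (hi.trans ht.2))]
  have hB : ∀ s ∈ Icc 0 T, ∀ t ∈ Icc 0 T, s ≤ t → |(Z t - Y t) - (Z s - Y s)| ≤ m t - m s := by
    intro s hs t ht hst
    convert hdom.abs_sub_le hconv s hs t ht hst using 2
    ring
  have hTT : T ∈ Icc 0 T := right_mem_Icc.2 hT.le
  refine ⟨n, f, g, A, fun t => Z t - Y t, m T + 1 + (m T - m 0 + 1), hf, hg, hA,
    continuousOn_of_abs_sub_le hdom.1 hB, boundedVariationOn_of_abs_sub_le hT.le hB, hξg,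
    fun t => by simp [Z], ?_⟩
  filter_upwards [hdom.2.2, (hdom.2.1 T hTT).eventually_le,
    (G.convTo_increments hdom.1 hTT).eventually_le] with N hN hP hmT
  refine le_trans ?_ (add_le_add hP hmT)
  rw [← G.gridSum_add]
  refine G.gridSum_le_gridSum N fun i hi => ?_
  have h1 := hN i hi
  have h2 := hB _ (G.left_mem_Icc hi) _ (G.right_mem_Icc hi) ((G.mono N).monotone i.le_succ)
  rw [← hξg _ (G.left_mem_Icc hi)] at h1
  refine le_trans (le_of_eq ?_) ((abs_sub _ _).trans (add_le_add h1 h2))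
  congr 1
  simp only [Z]
  ring

end ItoFormula

/-- associativity of the pathwise Itô integral (one-dimensional
case): if `Y = ∫ ξ dX` then `η ξ` is admissible for `X` and
`∫ η dY = ∫ η ξ dX`. -/
theorem stmt9 (G : GridSeq) (X Q ξ Y QY η : ℝ → ℝ)
    (hX : ContinuousOn X (Set.Ici 0)) (hQ : HasQV G X Q)
    (hξ : Admissible X ξ)
    (hY : ∀ t, ConvTo G (fun u v => ξ u * (X v - X u)) t (Y t)) (hY0 : Y 0 = 0)
    (hQY : HasQV G Y QY)
    (hQYint : ∀ t, ConvTo G (fun u v => (ξ u) ^ 2 * (Q v - Q u)) t (QY t))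
    (hη : Admissible Y η) :
    Admissible X (fun t => η t * ξ t) ∧
    ∀ t ≥ 0, ∃ I,
      ConvTo G (fun u v => η u * (Y v - Y u)) t I ∧
      ConvTo G (fun u v => η u * ξ u * (X v - X u)) t I := by
  have hXT : ∀ T, ContinuousOn X (Icc 0 T) := fun T => hX.mono Icc_subset_Ici_self
  refine ⟨fun T hT => ?_, fun t ht => ?_⟩
  · obtain ⟨n, f, g, A, B, -, hf, hg, hA, hBc, hBv, hξg, hYf, -⟩ :=
      exists_integral_representation G hT (hXT T) hQ hξ hY
    obtain ⟨l, h, D, hh, hD, hηh⟩ := hη T hT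
    let hd : (Fin (l + (n + 1)) → ℝ) → Fin l → ℝ := fun a i => a (Fin.castAdd (n + 1) i)
    let mid : (Fin (l + (n + 1)) → ℝ) → ℝ := fun a => a (Fin.natAdd l 0)
    let tl : (Fin (l + (n + 1)) → ℝ) → Fin n → ℝ := fun a i => a (Fin.natAdd l i.succ)
    refine ⟨l + (n + 1), fun a x => h (hd a) (f (tl a) x - mid a) * g (tl a) x,
      fun t => Fin.append (D t) (Fin.cons (B t) (A t)), ?_, fun k => ?_, fun t ht => ?_⟩
    · have hhd : ContDiff ℝ 1 hd := contDiff_pi.2 fun i => contDiff_apply ℝ ℝ _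
      have hmid : ContDiff ℝ 1 mid := contDiff_apply ℝ ℝ _
      have htl : ContDiff ℝ 1 tl := contDiff_pi.2 fun i => contDiff_apply ℝ ℝ _
      have htlx : ContDiff ℝ 1 fun p : (Fin (l + (n + 1)) → ℝ) × ℝ => (tl p.1, p.2) :=
        (htl.comp contDiff_fst).prodMk contDiff_snd
      exact (hh.comp ((hhd.comp contDiff_fst).prodMk
        ((hf.comp htlx).sub (hmid.comp contDiff_fst)))).mul (hg.comp htlx)
    · induction k using Fin.addCases with
      | left i => simpa using hD i
      | right i =>
        induction i using Fin.cases with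
        | zero => simpa using And.intro hBc hBv
        | succ i => simpa using hA i
    · simp [hd, mid, tl, hηh t ht, hξg t ht, hYf t]
  · have hT : 0 < t + 1 := by linarith
    have htT : t ∈ Icc 0 (t + 1) := ⟨ht, by linarith⟩
    obtain ⟨n, f, g, A, B, C, hf, hg, hA, hBc, -, hξg, hYf, hbd⟩ :=
      exists_integral_representation G hT (hXT _) hQ hξ hY
    have hYc : ContinuousOn Y (Icc 0 (t + 1)) := by
      refine ContinuousOn.congr ?_ fun s _ => hYf s
      exact (hf.continuous.comp_continuousOn
        ((continuousOn_pi.2 fun k => (hA k).1).prodMk (hXT _))).sub hBc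
    obtain ⟨l, h, D, hh, hD, hηh⟩ := hη _ hT
    obtain ⟨k, hk, hkh⟩ := exists_contDiff_primitive hh
    have hDY : ContinuousOn (fun s => (D s, Y s)) (Icc 0 (t + 1)) :=
      (continuousOn_pi.2 fun k => (hD k).1).prodMk hYc
    obtain ⟨L, hL⟩ := (ito_defect G hT hYc hQY hk hh hkh hD).2 t htT
    have hηY : ConvTo G (fun u v => η u * (Y v - Y u)) t
        (k (D t) (Y t) - k (D 0) (Y 0) - L) := by
      refine ((G.convTo_increments (h := fun s => k (D s) (Y s))
        (hk.continuous.comp_continuousOn hDY) htT).sub hL).congr fun N => ?_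
      rw [← G.gridSum_sub]
      refine G.gridSum_congr N fun i hi => ?_
      rw [hηh _ (G.left_mem_Icc (hi.trans htT.2))]
      ring
    have hηc : ContinuousOn η (Icc 0 (t + 1)) :=
      ContinuousOn.congr (hh.continuous.comp_continuousOn hDY) hηh
    have hzero : ∀ s ∈ Icc 0 (t + 1), ConvTo G
        (fun u v => Y v - Y u - ξ u * (X v - X u)) s 0 := by
      intro s hs
      have h1 := (G.convTo_increments hYc hs).sub (hY s)
      rw [hY0, sub_zero, sub_self] at h1
      exact h1.congr fun N => (G.gridSum_sub N _ _ s).symm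
    obtain ⟨L', hL', hL'0⟩ := G.exists_convTo_mul hzero hbd hηc htT
    refine ⟨_, hηY, ?_⟩
    have h1 := hηY.sub hL'
    rw [hL'0 fun _ _ => rfl, sub_zero] at h1
    refine h1.congr fun N => ?_
    rw [← G.gridSum_sub]
    exact G.gridSum_congr N fun i _ => by ring
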